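/- For every regular uncountable cardinal κ with κ ≥ ℶ_ω (the ω-th beth cardinal), the dominating number d_κ (defined modulo the bounded ideal) equals the club dominating number d^cl_κ (defined modulo the non-stationary ideal). -/

import Mathlib

open Set Cardinal

/-- `c` is a club in the well-ordered type `α` (thought of as the cardinal `κ = #α`):
it is closed (contains the supremum of each of its nonempty bounded subsets) and unbounded. -/
def IsClubIn {α : Type*} [LinearOrder α] (c : Set α) : Prop :=
  (∀ s ⊆ c, s.Nonempty → ∀ a : α, IsLUB s a → a ∈ c) ∧ ∀ a : α, ∃ b ∈ c, a < b

/-- `x` is stationary: it meets every club. -/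
def IsStatIn {α : Type*} [LinearOrder α] (x : Set α) : Prop :=
  ∀ c : Set α, IsClubIn c → (x ∩ c).Nonempty

/-- The dominating number `d_κ`, defined modulo the bounded ideal: the least cardinality of a
family `D ⊆ κ^κ` such that every `f ∈ κ^κ` satisfies `f ≤* g` for some `g ∈ D`,
i.e. `{a | g a < f a}` is bounded. -/
noncomputable def bddDominatingNumber (α : Type*) [LinearOrder α] : Cardinal :=
  sInf { c : Cardinal |
    ∃ D : Set (α → α), (∀ f : α → α, ∃ g ∈ D, BddAbove {a : α | g a < f a}) ∧ c = #D }

/-- The club dominating number `d^cl_κ`, defined modulo the non-stationary ideal: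
the least cardinality of a family `D ⊆ κ^κ` such that every `f ∈ κ^κ` satisfies
`f ≤*_cl g` for some `g ∈ D`, i.e. `{a | g a < f a}` is non-stationary. -/
noncomputable def clubDominatingNumber (α : Type*) [LinearOrder α] : Cardinal :=
  sInf { c : Cardinal |
    ∃ D : Set (α → α), (∀ f : α → α, ∃ g ∈ D, ¬ IsStatIn {a : α | g a < f a}) ∧ c = #D }

open Filter

universe u

/-- The cardinal `ℶ_ω`. -/
noncomputable abbrev bethOmega : Cardinal.{u} := Cardinal.beth Ordinal.omega0

theorem isStrongLimit_bethOmega : IsStrongLimit bethOmega.{u} :=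
  isStrongLimit_beth.2 Ordinal.isSuccLimit_omega0.isSuccPrelimit

theorem aleph0_le_bethOmega : ℵ₀ ≤ bethOmega.{u} := aleph0_le_beth _

theorem aleph0_lt_bethOmega : ℵ₀ < bethOmega.{u} := by
  rw [← beth_zero]
  exact beth_strictMono Ordinal.omega0_pos

theorem power_lt_bethOmega {a b : Cardinal.{u}} (ha : a < bethOmega) (hb : b < bethOmega) :
    a ^ b < bethOmega :=
  calc a ^ b ≤ (2 ^ a) ^ b := power_le_power_right (cantor a).le
    _ = 2 ^ (a * b) := (power_mul ..).symm
    _ < bethOmega := isStrongLimit_bethOmega.isStrongPrelimit (mul_lt_of_lt aleph0_le_bethOmega ha hb)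

theorem beth_natCast_lt_bethOmega (n : ℕ) : Cardinal.beth (n : Ordinal.{u}) < bethOmega :=
  beth_strictMono (Ordinal.natCast_lt_omega0 n)

theorem exists_le_beth_of_lt_bethOmega {c : Cardinal.{u}} (h : c < bethOmega) :
    ∃ n : ℕ, c ≤ Cardinal.beth (n : Ordinal.{u}) := by
  rw [bethOmega, beth_limit Ordinal.isSuccLimit_omega0] at h
  obtain ⟨⟨i, hi⟩, h⟩ := exists_lt_of_lt_ciSup' h
  obtain ⟨n, rfl⟩ := Ordinal.lt_omega0.1 hi
  exact ⟨n, h.le⟩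

theorem mk_lt_bethOmega_of_countable {α : Type u} {s : Set α} (hs : s.Countable) :
    #s < bethOmega :=
  (Cardinal.le_aleph0_iff_set_countable.2 hs).trans_lt aleph0_lt_bethOmega

/-- In a well-order of size larger than `c`, some proper initial segment has size at least `c`. -/
theorem exists_le_mk_Iio {X : Type u} [LinearOrder X] [WellFoundedLT X] {c : Cardinal.{u}}
    (h : c < #X) : ∃ a : X, c ≤ #(Iio a) := by
  have h' : c.ord < Ordinal.type ((· < ·) : X → X → Prop) := by
    by_contra! hle
    refine h.not_ge ?_
    simpa using Ordinal.card_le_card hle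
  obtain ⟨a, ha⟩ := Ordinal.typein_surj (· < ·) h'
  refine ⟨a, ?_⟩
  have := congrArg Ordinal.card ha
  rw [Ordinal.card_typein, card_ord] at this
  exact this.ge

theorem mk_iUnion_le_of_le {ι α : Type u} {f : ι → Set α} {c : Cardinal.{u}} (hι : #ι ≤ c)
    (hc : ℵ₀ ≤ c) (hf : ∀ i, #(f i) ≤ c) : #(⋃ i, f i) ≤ c :=
  calc #(⋃ i, f i) ≤ Cardinal.sum fun i => #(f i) := mk_iUnion_le_sum_mk
    _ ≤ Cardinal.sum fun _ : ι => c := sum_le_sum _ _ hf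
    _ = #ι * c := by simp
    _ ≤ c := mul_le_of_le hc hι le_rfl

/-- Every function `Θ → X` is covered by at most `σ` of the members of a family of size `≤ ν`. -/
def HasCover (ν σ : Cardinal.{u}) (Θ X : Type u) : Prop :=
  ∃ F : Set (Θ → X), #F ≤ ν ∧ ∀ x : Θ → X, ∃ T ⊆ F, #T ≤ σ ∧ ∀ j, ∃ t ∈ T, t j = x j

theorem HasCover.congr {ν σ : Cardinal.{u}} {Θ X Y : Type u} (e : X ≃ Y)
    (h : HasCover ν σ Θ X) : HasCover ν σ Θ Y := by
  obtain ⟨F, hF, h⟩ := h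
  refine ⟨(fun t => e ∘ t) '' F, mk_image_le.trans hF, fun x => ?_⟩
  obtain ⟨T, hT, hc, hx⟩ := h (e.symm ∘ x)
  refine ⟨(fun t => e ∘ t) '' T, image_mono hT, mk_image_le.trans hc, fun j => ?_⟩
  obtain ⟨t, ht, htj⟩ := hx j
  exact ⟨_, mem_image_of_mem _ ht, by simp [htj]⟩

theorem HasCover.mono {ν σ σ' : Cardinal.{u}} {Θ X : Type u} (h : σ ≤ σ')
    (hc : HasCover ν σ Θ X) : HasCover ν σ' Θ X := by
  obtain ⟨F, hF, hc⟩ := hc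
  refine ⟨F, hF, fun x => ?_⟩
  obtain ⟨T, hT, hσ, hx⟩ := hc x
  exact ⟨T, hT, hσ.trans h, hx⟩

section Bad

variable {Θ L : Type u} [LinearOrder L]

/-- No family of `≤ #L` functions `Θ → L` meets, `D`-positively, every function below `f`. -/
def Bad (D : Filter Θ) (f : Θ → WithTop L) : Prop :=
  ∀ F : Set (Θ → L), #F ≤ #L →
    ∃ x : Θ → L, (∀ᶠ j in D, (x j : WithTop L) < f j) ∧ ∀ t ∈ F, ∀ᶠ j in D, x j ≠ t j

theorem Bad.mono {D D' : Filter Θ} {f : Θ → WithTop L} (h : D' ≤ D) (hb : Bad D f) :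
    Bad D' f := by
  intro F hF
  obtain ⟨x, hx, ht⟩ := hb F hF
  exact ⟨x, hx.filter_mono h, fun t htF => (ht t htF).filter_mono h⟩

theorem Bad.exists_lt {D : Filter Θ} {f : Θ → WithTop L} (hb : Bad D f) :
    ∃ x : Θ → L, ∀ᶠ j in D, (x j : WithTop L) < f j := by
  obtain ⟨x, hx, -⟩ := hb ∅ (by simp)
  exact ⟨x, hx⟩

theorem not_bad_iff {D : Filter Θ} {f : Θ → WithTop L} : ¬ Bad D f ↔
    ∃ F : Set (Θ → L), #F ≤ #L ∧ ∀ x : Θ → L, (∀ᶠ j in D, (x j : WithTop L) < f j) →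
      ∃ t ∈ F, ∃ᶠ j in D, x j = t j := by
  simp only [Bad, not_forall, not_exists, not_and, exists_prop, ne_eq, Filter.Frequently]

/-- If `Θ` has no countable covers, then some countably complete filter is bad. -/
theorem exists_bad_top (hL : bethOmega ≤ #L) (hΘ : #Θ < bethOmega.{u})
    (hn : ¬ HasCover #L ℵ₀ Θ L) :
    ∃ D : Filter Θ, D.NeBot ∧ CountableInterFilter D ∧ Bad D fun _ => (⊤ : WithTop L) := by
  by_contra! hcon
  let I := {D : Filter Θ // D.NeBot ∧ CountableInterFilter D}
  have hI : #I ≤ #L := by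
    refine (mk_subtype_le _).trans (le_trans ?_ hL)
    refine (mk_le_of_injective (f := fun D : Filter Θ => D.sets)
      fun _ _ h => Filter.filter_eq h).trans ?_
    rw [mk_set, mk_set]
    exact (isStrongLimit_bethOmega.isStrongPrelimit (isStrongLimit_bethOmega.isStrongPrelimit hΘ)).le
  have hF : ∀ D : I, _ := fun D => not_bad_iff.1 (hcon D.1 D.2.1 D.2.2)
  choose F hFc hF using hF
  apply hn
  refine ⟨⋃ D, F D, ?_, fun x => ?_⟩
  · exact mk_iUnion_le_of_le hI (aleph0_le_bethOmega.trans hL) hFc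
  by_contra! hx
  let D : Filter Θ := Filter.ofCountableUnion
    {s | ∃ T ⊆ ⋃ D, F D, #T ≤ ℵ₀ ∧ ∀ j ∈ s, ∃ t ∈ T, t j = x j}
    (by
      intro S hS h
      choose! T hT hTc hTx using h
      refine ⟨⋃ s ∈ S, T s, iUnion₂_subset hT, ?_, ?_⟩
      · rw [le_aleph0_iff_set_countable]
        exact hS.biUnion fun s hs => le_aleph0_iff_set_countable.1 (hTc s hs)
      · rintro j ⟨s, hs, hj⟩
        obtain ⟨t, ht, h⟩ := hTx s hs j hj
        exact ⟨t, mem_biUnion hs ht, h⟩)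
    (by
      rintro t ⟨T, hT, hc, h⟩ s hst
      exact ⟨T, hT, hc, fun j hj => h j (hst hj)⟩)
  have hD : D.NeBot := by
    refine ⟨fun h => ?_⟩
    have : (∅ : Set Θ) ∈ D := h ▸ mem_bot
    rw [mem_ofCountableUnion, compl_empty] at this
    obtain ⟨T, hT, hc, h⟩ := this
    obtain ⟨j, hj⟩ := hx T hT hc
    obtain ⟨t, ht, e⟩ := h j trivial
    exact hj t ht e
  obtain ⟨t, ht, hf⟩ := hF ⟨D, hD, inferInstance⟩ x (by simp)
  refine hf ?_
  change _ ∈ D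
  rw [mem_ofCountableUnion]
  refine ⟨{t}, ?_, by simp, ?_⟩
  · exact singleton_subset_iff.2 (mem_iUnion.2 ⟨_, ht⟩)
  · intro j hj
    simpa [eq_comm] using hj

end Bad

section Critical

theorem wellFounded_eventually_lt {Θ γ : Type*} [LT γ] [WellFoundedLT γ] (D : Filter Θ)
    [D.NeBot] [CountableInterFilter D] :
    WellFounded fun f g : Θ → γ => ∀ᶠ j in D, f j < g j := by
  rw [wellFounded_iff_isEmpty_descending_chain]
  refine ⟨fun ⟨f, hf⟩ => ?_⟩
  obtain ⟨j, hj⟩ := (eventually_countable_forall.2 hf).exists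
  exact (wellFounded_iff_isEmpty_descending_chain.1 (wellFounded_lt (α := γ))).false
    ⟨fun n => f n j, hj⟩

variable {Θ L : Type u} [LinearOrder L]

/-- `f` is a minimal bad bound for `D`, and this minimality persists on all `E`-positive sets. -/
structure IsCritical (D E : Filter Θ) (f : Θ → WithTop L) : Prop where
  bad : Bad D f
  le : E ≤ D
  not_bad : ∀ C : Set Θ, (∃ᶠ j in E, j ∈ C) → ∀ f' : Θ → WithTop L,
    (∀ᶠ j in D, f' j < f j) → ¬ Bad (D ⊓ 𝓟 C) f'

theorem IsCritical.mono {D E E' : Filter Θ} {f : Θ → WithTop L} (h : IsCritical D E f)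
    (hE : E' ≤ E) : IsCritical D E' f :=
  ⟨h.bad, hE.trans h.le, fun C hC => h.not_bad C (hC.filter_mono hE)⟩

theorem Bad.exists_isCritical [WellFoundedLT L] {D : Filter Θ} [D.NeBot]
    [CountableInterFilter D] {f₀ : Θ → WithTop L} (h₀ : Bad D f₀) :
    ∃ (f : Θ → WithTop L) (E : Filter Θ), E.NeBot ∧ CountableInterFilter E ∧
      IsCritical D E f := by
  obtain ⟨f, hf, hmin⟩ := (wellFounded_eventually_lt (γ := WithTop L) D).has_min
    {f | Bad D f} ⟨f₀, h₀⟩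
  obtain ⟨x₀, hx₀⟩ := Bad.exists_lt hf
  let J : Set (Set Θ) := {C | ∃ f' : Θ → WithTop L, (∀ᶠ j in D, f' j < f j) ∧
    Bad (D ⊓ 𝓟 C) f'}
  have hmono : ∀ t ∈ J, ∀ s ⊆ t, s ∈ J := by
    rintro t ⟨f', h, hb⟩ s hst
    exact ⟨f', h, hb.mono (inf_le_inf_left _ (principal_mono.2 hst))⟩
  have hunion : ∀ S : Set (Set Θ), S.Countable → (∀ s ∈ S, s ∈ J) → ⋃₀ S ∈ J := by
    classical
    intro S hS h
    choose! g hg hb using h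
    let k : Θ → Set Θ := fun j => if h : ∃ s ∈ S, j ∈ s then h.choose else ∅
    have hk : ∀ j ∈ ⋃₀ S, k j ∈ S ∧ j ∈ k j := by
      intro j hj
      have h : ∃ s ∈ S, j ∈ s := hj
      simpa only [k, dif_pos h] using h.choose_spec
    refine ⟨fun j => if j ∈ ⋃₀ S then g (k j) j else x₀ j, ?_, fun F hF => ?_⟩
    · filter_upwards [(eventually_countable_ball hS).2 hg, hx₀] with j hj hj₀
      split_ifs with h
      · exact hj _ (hk j h).1
      · exact hj₀
    · have : Nonempty (Θ → L) := ⟨x₀⟩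
      choose! x hx ht using fun s hs => hb s hs F hF
      refine ⟨fun j => x (k j) j, ?_, fun t htF => ?_⟩
      · have := (eventually_countable_ball hS).2 fun s hs => eventually_inf_principal.1 (hx s hs)
        rw [eventually_inf_principal]
        filter_upwards [this] with j hj hjS
        simpa only [if_pos hjS] using hj _ (hk j hjS).1 (hk j hjS).2
      · have := (eventually_countable_ball hS).2 fun s hs =>
          eventually_inf_principal.1 (ht s hs t htF)
        rw [eventually_inf_principal]
        filter_upwards [this] with j hj hjS
        exact hj _ (hk j hjS).1 (hk j hjS).2
  have huniv : Set.univ ∉ J := by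
    rintro ⟨f', hlt, hb⟩
    rw [principal_univ, inf_top_eq] at hb
    exact hmin f' hb hlt
  refine ⟨f, Filter.ofCountableUnion J hunion hmono, ⟨fun h => ?_⟩, inferInstance,
    hf, fun s hs => ?_, fun C hC f' hlt hb => hC ?_⟩
  · have : (∅ : Set Θ) ∈ Filter.ofCountableUnion J hunion hmono := h ▸ mem_bot
    rw [mem_ofCountableUnion, compl_empty] at this
    exact huniv this
  · rw [mem_ofCountableUnion]
    refine ⟨fun j => x₀ j, hx₀, fun F _ => ⟨x₀, ?_, fun t _ => ?_⟩⟩ <;>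
    · rw [eventually_inf_principal]
      filter_upwards [hs] with j hj hj'
      exact absurd hj hj'
  · change Cᶜ ∈ Filter.ofCountableUnion J hunion hmono
    rw [mem_ofCountableUnion, compl_compl]
    exact ⟨f', hlt, hb⟩

/-- The initial segment below `b` has a cofinal subset of size less than `ℶ_ω`. -/
def SmallCof (b : WithTop L) : Prop :=
  ∃ S : Set L, (∀ s ∈ S, (s : WithTop L) < b) ∧ #S < bethOmega ∧
    ∀ a : L, (a : WithTop L) < b → ∃ s ∈ S, a ≤ s

theorem exists_range_cofinal {β : Type u} {b : WithTop L} {S : Set L} (hS : ∀ s ∈ S, ↑s < b)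
    (hc : #S ≤ #β) (hcof : ∀ a : L, ↑a < b → ∃ s ∈ S, a ≤ s) (x₀ : L) (hx₀ : ↑x₀ < b) :
    ∃ c : β → L, (∀ i, ↑(c i) < b) ∧ ∀ a : L, ↑a < b → ∃ i, a ≤ c i := by
  obtain ⟨e⟩ := hc
  obtain ⟨s₀, hs₀, -⟩ := hcof x₀ hx₀
  have : Nonempty S := ⟨⟨s₀, hs₀⟩⟩
  refine ⟨fun i => (Function.invFun e i : S), fun i => hS _ (Subtype.prop _), fun a ha => ?_⟩
  obtain ⟨s, hs, h⟩ := hcof a ha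
  exact ⟨e ⟨s, hs⟩, by
    simpa only [Function.leftInverse_invFun e.injective _] using h⟩

theorem IsCritical.eventually_not_smallCof (hL : bethOmega ≤ #L) (hΘ : #Θ < bethOmega.{u})
    {D E : Filter Θ} [CountableInterFilter E] {f : Θ → WithTop L} (h : IsCritical D E f) :
    ∀ᶠ j in E, ¬ SmallCof (f j) := by
  classical
  obtain ⟨x₀, hx₀⟩ := h.bad.exists_lt
  let B (n : ℕ) (j : Θ) : Prop := ∃ S : Set L, (∀ s ∈ S, (s : WithTop L) < f j) ∧
    #S ≤ Cardinal.beth (n : Ordinal.{u}) ∧ ∀ a : L, (a : WithTop L) < f j → ∃ s ∈ S, a ≤ s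
  suffices ∀ n, ∀ᶠ j in E, ¬ B n j by
    filter_upwards [eventually_countable_forall.2 this] with j hj hs
    obtain ⟨S, hS, hc, hcof⟩ := hs
    obtain ⟨n, hn⟩ := exists_le_beth_of_lt_bethOmega hc
    exact hj n ⟨S, hS, hn, hcof⟩
  intro n
  by_contra hn
  let C := {j | B n j}
  replace hn : ∃ᶠ j in E, j ∈ C := hn
  let β : Type u := (Cardinal.beth (n : Ordinal.{u})).out
  have hβ : #β = Cardinal.beth (n : Ordinal.{u}) := mk_out _
  have hc : ∀ j, ∃ c : β → L, j ∈ C → ↑(x₀ j) < f j →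
      (∀ i, ↑(c i) < f j) ∧ ∀ a : L, ↑a < f j → ∃ i, a ≤ c i := by
    intro j
    by_cases hj : j ∈ C ∧ ↑(x₀ j) < f j
    · obtain ⟨⟨S, hS, hc, hcof⟩, hx⟩ := hj
      obtain ⟨c, hc⟩ := exists_range_cofinal hS (hc.trans_eq hβ.symm) hcof (x₀ j) hx
      exact ⟨c, fun _ _ => hc⟩
    · exact ⟨fun _ => x₀ j, fun h₁ h₂ => absurd ⟨h₁, h₂⟩ hj⟩
  choose c hc using hc
  let g (η : Θ → β) (j : Θ) : L := if j ∈ C ∧ ↑(x₀ j) < f j then c j (η j) else x₀ j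
  have hg : ∀ η, ∀ᶠ j in D, (g η j : WithTop L) < f j := by
    intro η
    filter_upwards [hx₀] with j hj
    by_cases hjC : j ∈ C
    · simpa only [g, if_pos (And.intro hjC hj)] using (hc j hjC hj).1 _
    · simpa only [g, hjC, false_and, if_false] using hj
  choose F hFc hF using fun η => not_bad_iff.1 (h.not_bad C hn (fun j => g η j) (hg η))
  have hηc : #(Θ → β) ≤ #L := by
    refine le_trans (le_of_lt ?_) hL
    rw [← power_def]
    exact power_lt_bethOmega (hβ.trans_lt (beth_natCast_lt_bethOmega n)) hΘ
  have hinf : ℵ₀ ≤ #L := aleph0_le_bethOmega.trans hL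
  obtain ⟨x, hx, hne⟩ := h.bad ((⋃ η, F η) ∪ range g) <| by
    refine (mk_union_le _ _).trans (add_le_of_le hinf ?_ (mk_range_le.trans hηc))
    exact mk_iUnion_le_of_le hηc hinf hFc
  have hη : ∀ j, ∃ i : β, j ∈ C → ↑(x₀ j) < f j → ↑(x j) < f j → x j ≤ c j i := by
    intro j
    by_cases hj : j ∈ C ∧ ↑(x₀ j) < f j ∧ ↑(x j) < f j
    · obtain ⟨i, hi⟩ := (hc j hj.1 hj.2.1).2 _ hj.2.2
      exact ⟨i, fun _ _ _ => hi⟩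
    · have : #β ≠ 0 := hβ.trans_ne (aleph0_pos.trans_le (aleph0_le_beth _)).ne'
      obtain ⟨i⟩ := mk_ne_zero_iff.1 this
      exact ⟨i, fun h₁ h₂ h₃ => absurd ⟨h₁, h₂, h₃⟩ hj⟩
  choose η hη using hη
  obtain ⟨t, ht, hfreq⟩ := hF η x <| by
    rw [eventually_inf_principal]
    filter_upwards [hx₀, hx, hne (g η) (Or.inr ⟨η, rfl⟩)] with j h₁ h₂ h₃ hj
    rw [WithTop.coe_lt_coe]
    refine lt_of_le_of_ne ?_ h₃
    simpa only [g, if_pos (And.intro hj h₁)] using hη j hj h₁ h₂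
  exact hfreq ((hne t (Or.inl (mem_iUnion.2 ⟨η, ht⟩))).filter_mono inf_le_left)

end Critical

section Envelope

variable {Θ L : Type u} [LinearOrder L]

/-- Every small set of elements below `b` has a strict upper bound below `b` satisfying `Q`. -/
def RichBelow (Q : L → Prop) (b : WithTop L) : Prop :=
  ∀ S : Set L, (∀ s ∈ S, (s : WithTop L) < b) → #S < bethOmega →
    ∃ a : L, ↑a < b ∧ Q a ∧ ∀ s ∈ S, s < a

theorem exists_strict_bound_of_not_smallCof {b : WithTop L} (hb : ¬ SmallCof b) {S : Set L}
    (hS : ∀ s ∈ S, ↑s < b) (hc : #S < bethOmega) : ∃ a : L, ↑a < b ∧ ∀ s ∈ S, s < a := by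
  by_contra! h
  exact hb ⟨S, hS, hc, h⟩

theorem exists_richBelow {b : WithTop L} (hb : ¬ SmallCof b) {Q : ℕ → L → Prop} {m : L}
    (hm : ↑m < b) (hQ : ∀ a, m ≤ a → ∃ n, Q n a) : ∃ n, RichBelow (Q n) b := by
  by_contra! h
  simp only [RichBelow, not_forall] at h
  choose S hS hc hno using h
  choose a ha hSa using fun n => exists_strict_bound_of_not_smallCof hb (hS n) (hc n)
  obtain ⟨a', ha', hlt⟩ := exists_strict_bound_of_not_smallCof hb (S := insert m (range a))
    (by rintro s (rfl | ⟨n, rfl⟩); exacts [hm, ha n])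
    (mk_lt_bethOmega_of_countable ((countable_range a).insert m))
  obtain ⟨n, hn⟩ := hQ a' (hlt m (mem_insert _ _)).le
  exact hno n ⟨a', ha', hn, fun s hs =>
    (hSa n s hs).trans (hlt _ (mem_insert_of_mem _ ⟨n, rfl⟩))⟩

/-- If all elements below `b` have small initial segments, `b` has small cofinality. -/
theorem smallCof_of_mk_Iio_lt [WellFoundedLT L] {b : WithTop L}
    (hb : ∀ a : L, ↑a < b → #(Iio a) < bethOmega) : SmallCof b := by
  by_cases hc : ∃ n : ℕ, ∀ a : L, ↑a < b → #(Iio a) < Cardinal.beth (n : Ordinal.{u})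
  · obtain ⟨n, hn⟩ := hc
    refine ⟨{a : L | ↑a < b}, fun _ => id, ?_, fun a ha => ⟨a, ha, le_rfl⟩⟩
    refine lt_of_le_of_lt ?_ (beth_natCast_lt_bethOmega n)
    by_contra! h
    obtain ⟨a, ha⟩ := exists_le_mk_Iio h
    refine (hn a a.2).not_ge (ha.trans ?_)
    exact mk_le_of_injective (f := fun z : Iio a => (⟨z.1.1, z.2⟩ : Iio (a : L)))
      fun x y h => Subtype.ext (Subtype.ext (congrArg (fun w : Iio (a : L) => (w : L)) h))
  · push Not at hc
    choose a ha hle using hc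
    refine ⟨range a, by rintro _ ⟨n, rfl⟩; exact ha n,
      mk_lt_bethOmega_of_countable (countable_range a), fun z hz => ?_⟩
    obtain ⟨n, hn⟩ := exists_le_beth_of_lt_bethOmega (hb z hz)
    by_contra! h
    have hlt : a (n + 1) < z := h _ ⟨_, rfl⟩
    have : Cardinal.beth (n : Ordinal.{u}) < Cardinal.beth ((n + 1 : ℕ) : Ordinal.{u}) :=
      beth_strictMono (by exact_mod_cast n.lt_succ_self)
    exact (this.trans_le ((hle (n + 1)).trans
      ((mk_le_mk_of_subset (Iio_subset_Iio hlt.le)).trans hn))).false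

theorem Bad.exists_family [WellFoundedLT L] (hI : ∀ a : L, #(Iio a) < #L) {D : Filter Θ}
    {f : Θ → WithTop L} (hb : Bad D f) : ∃ x : L → Θ → L,
      (∀ a, ∀ᶠ j in D, (x a j : WithTop L) < f j) ∧
      ∀ a b, a ≠ b → ∀ᶠ j in D, x a j ≠ x b j := by
  have : Nonempty (Θ → L) := hb.exists_lt.nonempty
  choose! pick hlt hne using hb
  let x : L → Θ → L := (wellFounded_lt (α := L)).fix
    fun a ih => pick (range fun b : Iio a => ih b b.2)
  have hx : ∀ a, x a = pick (range fun b : Iio a => x b) := fun a =>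
    (wellFounded_lt (α := L)).fix_eq _ a
  have hc : ∀ a, #(range fun b : Iio a => x b) ≤ #L := fun a => mk_range_le.trans (hI a).le
  have key : ∀ a b, b < a → ∀ᶠ j in D, x a j ≠ x b j := fun a b hab => by
    have := hne _ (hc a) (x b) ⟨⟨b, hab⟩, rfl⟩
    rwa [← hx] at this
  refine ⟨x, fun a => ?_, fun a b hab => ?_⟩
  · rw [hx]
    exact hlt _ (hc a)
  · rcases hab.lt_or_gt with h | h
    · simpa only [ne_comm] using key b a h
    · exact key a b h

/-- A function below `f` can be strictly increased, on rich coordinates, to satisfy `Q`. -/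
theorem exists_raise {D E : Filter Θ} {f : Θ → WithTop L} {Q : L → Prop} (hE : E ≤ D)
    (hR : ∀ᶠ j in E, RichBelow Q (f j)) {e : Θ → L} (he : ∀ᶠ j in D, (e j : WithTop L) < f j) :
    ∃ e' : Θ → L, (∀ᶠ j in D, (e' j : WithTop L) < f j) ∧ ∀ᶠ j in E, Q (e' j) ∧ e j < e' j := by
  have : ∀ j, ∃ a : L, (↑(e j) < f j → ↑a < f j) ∧ (↑(e j) < f j → RichBelow Q (f j) →
      Q a ∧ e j < a) := by
    intro j
    by_cases h : ↑(e j) < f j ∧ RichBelow Q (f j)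
    · obtain ⟨a, ha, hQ, hlt⟩ := h.2 {e j} (by simpa using h.1)
        (mk_lt_bethOmega_of_countable (countable_singleton _))
      exact ⟨a, fun _ => ha, fun _ _ => ⟨hQ, hlt _ rfl⟩⟩
    · exact ⟨e j, id, fun h₁ h₂ => absurd ⟨h₁, h₂⟩ h⟩
  choose e' h₁ h₂ using this
  refine ⟨e', he.mono h₁, ?_⟩
  filter_upwards [hE he, hR] with j hj hj'
  exact h₂ j hj hj'

/-- There are few functions below `f` bounding, on positive sets, all small subfamilies of `x`. -/
theorem exists_bounding_family (hL : bethOmega ≤ #L) {D E : Filter Θ} [E.NeBot]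
    {f : Θ → WithTop L} {Q : L → Prop} (hE : E ≤ D) (hR : ∀ᶠ j in E, RichBelow Q (f j))
    {x : L → Θ → L} (hx : ∀ a, ∀ᶠ j in D, (x a j : WithTop L) < f j)
    {I : Type u} (hI : #I < bethOmega.{u}) :
    ∃ 𝓔 : Set (Θ → L), #𝓔 ≤ #L ∧ (∀ e ∈ 𝓔, ∀ᶠ j in D, (e j : WithTop L) < f j) ∧
      (∀ e ∈ 𝓔, ∀ᶠ j in E, Q (e j)) ∧
      ∀ g : I → L, ∃ e ∈ 𝓔, ∀ i, ∃ᶠ j in E, x (g i) j < e j := by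
  let P : Set (Θ → L) := {e | ∀ᶠ j in D, (e j : WithTop L) < f j}
  choose! r hr₁ hr₂ using fun e (he : e ∈ P) => exists_raise hE hR he
  suffices ∃ 𝓔 ⊆ P, #𝓔 ≤ #L ∧ ∀ g : I → L, ∃ e ∈ 𝓔, ∀ i, ∃ᶠ j in E, x (g i) j ≤ e j by
    obtain ⟨𝓔, hP, hc, h⟩ := this
    refine ⟨r '' 𝓔, mk_image_le.trans hc, ?_, ?_, fun g => ?_⟩
    · rintro _ ⟨e, he, rfl⟩
      exact hr₁ e (hP he)
    · rintro _ ⟨e, he, rfl⟩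
      exact (hr₂ e (hP he)).mono fun _ => And.left
    · obtain ⟨e, he, hg⟩ := h g
      refine ⟨r e, mem_image_of_mem r he, fun i => ?_⟩
      exact ((hg i).and_eventually (hr₂ e (hP he))).mono fun j hj => hj.1.trans_lt hj.2.2
  by_cases hA : ∃ 𝓔 ⊆ P, #𝓔 ≤ #L ∧ ∀ e ∈ P, ∃ e' ∈ 𝓔, ∃ᶠ j in E, e j ≤ e' j
  · obtain ⟨𝓔, hP, hc, h⟩ := hA
    refine ⟨𝓔, hP, hc, fun g => ?_⟩
    obtain ⟨a₀⟩ : Nonempty L := mk_ne_zero_iff.1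
      ((aleph0_pos.trans_le aleph0_le_bethOmega).trans_le hL).ne'
    have : ∀ j, ∃ a : L, (↑(x a₀ j) < f j → ↑a < f j) ∧ (RichBelow Q (f j) →
        ∀ i, ↑(x (g i) j) < f j → x (g i) j < a) := by
      intro j
      by_cases hj : RichBelow Q (f j)
      · obtain ⟨a, ha, -, hlt⟩ := hj {b | ∃ i, x (g i) j = b ∧ (b : WithTop L) < f j}
          (fun b hb => by obtain ⟨i, -, h⟩ := hb; exact h)
          ((mk_le_mk_of_subset (t := range fun i => x (g i) j)
            fun b hb => by obtain ⟨i, h, -⟩ := hb; exact ⟨i, h⟩).trans_lt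
              (mk_range_le.trans_lt hI))
        exact ⟨a, fun _ => ha, fun _ i hi => hlt _ ⟨i, rfl, hi⟩⟩
      · exact ⟨x a₀ j, id, fun h => absurd h hj⟩
    choose e he₁ he₂ using this
    obtain ⟨e', he', hfr⟩ := h e ((hx a₀).mono he₁)
    refine ⟨e', he', fun i => ?_⟩
    refine (hfr.and_eventually (hR.and (hE (hx (g i))))).mono ?_
    rintro j ⟨h₁, h₂, h₃⟩
    exact (he₂ j h₂ i h₃).le.trans h₁
  · push Not at hA
    obtain ⟨e, he, hlt⟩ := hA (range x) (by rintro _ ⟨a, rfl⟩; exact hx a) mk_range_le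
    refine ⟨{e}, singleton_subset_iff.2 he, ?_, fun g => ⟨e, rfl, fun i => ?_⟩⟩
    · rw [mk_singleton]
      exact one_le_aleph0.trans (aleph0_le_bethOmega.trans hL)
    · exact ((hlt _ ⟨g i, rfl⟩).mono fun _ => le_of_lt).frequently

end Envelope

section Cover

/-- The values below `b` of any function `y : I → L` can be recovered from few codes below `b`. -/
def IsCoded {L : Type u} [LinearOrder L] (σ : Cardinal.{u}) (I : Type u) (b : L) : Prop :=
  ∃ G : L → I → L, ∀ y : I → L, ∃ τ : σ.out → L, (∀ s, τ s < b) ∧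
    ∀ i, y i < b → ∃ s, G (τ s) i = y i

theorem HasCover.isCoded {L : Type u} [LinearOrder L] {σ : Cardinal.{u}} {I : Type u} {b : L}
    (hb : (Iio b).Nonempty) (h : HasCover #(Iio b) σ I (Iio b)) : IsCoded σ I b := by
  classical
  obtain ⟨F, ⟨code⟩, hF⟩ := h
  obtain ⟨b₀, hb₀⟩ := hb
  refine ⟨fun a i => if h : ∃ t : F, (code t : L) = a then (h.choose : I → Iio b) i else a,
    fun y => ?_⟩
  obtain ⟨T, hT, hc, hy⟩ := hF fun i => if h : y i < b then ⟨y i, h⟩ else ⟨b₀, hb₀⟩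
  rw [← mk_out σ] at hc
  obtain ⟨k⟩ := hc
  let τ (s : σ.out) : Iio b := if h : ∃ t : T, k t = s then code ⟨h.choose, hT h.choose.2⟩
    else ⟨b₀, hb₀⟩
  refine ⟨fun s => τ s, fun s => (τ s).2, fun i hi => ?_⟩
  obtain ⟨t, ht, hti⟩ := hy i
  have h₁ : ∃ t' : T, k t' = k ⟨t, ht⟩ := ⟨_, rfl⟩
  have h₂ : τ (k ⟨t, ht⟩) = code ⟨t, hT ht⟩ := by
    simp only [τ, dif_pos h₁]
    congr 2
    exact congrArg Subtype.val (k.injective h₁.choose_spec)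
  have h₃ : ∃ t' : F, (code t' : L) = code ⟨t, hT ht⟩ := ⟨_, rfl⟩
  have h₄ : (h₃.choose : I → Iio b) = t :=
    congrArg Subtype.val (code.injective (Subtype.ext h₃.choose_spec))
  refine ⟨k ⟨t, ht⟩, ?_⟩
  simp only [h₂, dif_pos h₃]
  rw [h₄, hti, dif_pos hi]

variable {Θ L : Type u} [LinearOrder L]

theorem IsCritical.hasCover (hL : bethOmega ≤ #L) (hΘ : #Θ < bethOmega.{u}) {D E : Filter Θ}
    [E.NeBot] {f : Θ → WithTop L} (h : IsCritical D E f) {x : L → Θ → L}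
    (hxlt : ∀ a, ∀ᶠ j in D, (x a j : WithTop L) < f j)
    (hxne : ∀ a b, a ≠ b → ∀ᶠ j in D, x a j ≠ x b j)
    {σ : Cardinal.{u}} {I : Type u} (hI : #I < bethOmega.{u}) {Q : L → Prop}
    (hQ : ∀ b, Q b → IsCoded σ I b) (hR : ∀ᶠ j in E, RichBelow Q (f j)) :
    HasCover #L #((Θ → σ.out) × Set Θ) I L := by
  classical
  have hinf : ℵ₀ ≤ #L := aleph0_le_bethOmega.trans hL
  obtain ⟨𝓔, h𝓔c, h𝓔f, h𝓔Q, h𝓔⟩ := exists_bounding_family hL h.le hR hxlt hI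
  obtain ⟨a₀⟩ : Nonempty L := mk_ne_zero_iff.1 (aleph0_pos.trans_le hinf).ne'
  have hG : ∀ b : L, ∃ G : L → I → L, Q b → ∀ y : I → L, ∃ τ : σ.out → L, (∀ s, τ s < b) ∧
      ∀ i, y i < b → ∃ s, G (τ s) i = y i := by
    intro b
    by_cases hb : Q b
    · obtain ⟨G, hG⟩ := hQ b hb
      exact ⟨G, fun _ => hG⟩
    · exact ⟨fun _ _ => a₀, fun h => absurd h hb⟩
  choose G hG using hG
  have hF : ∀ (e : 𝓔) (C : Set Θ), ∃ F : Set (Θ → L), #F ≤ #L ∧ ((∃ᶠ j in E, j ∈ C) →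
      ∀ z : Θ → L, (∀ᶠ j in D ⊓ 𝓟 C, z j < e.1 j) → ∃ t ∈ F, ∃ᶠ j in D ⊓ 𝓟 C, z j = t j) := by
    intro e C
    by_cases hC : ∃ᶠ j in E, j ∈ C
    · obtain ⟨F, hFc, hF⟩ := not_bad_iff.1 (h.not_bad C hC (fun j => e.1 j) (h𝓔f e e.2))
      exact ⟨F, hFc, fun _ z hz => hF z (by simpa using hz)⟩
    · exact ⟨∅, by simp, fun h => absurd h hC⟩
  choose F hFc hF using hF
  let Φ (e t : Θ → L) (A : Set Θ) (i : I) : L :=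
    if h : ∃ a, ∀ j ∈ A, G (e j) (t j) i = x a j then h.choose else a₀
  have hsmall : #(Set Θ) ≤ #L := by
    rw [mk_set]
    exact (isStrongLimit_bethOmega.isStrongPrelimit hΘ).le.trans hL
  refine ⟨⋃ e : 𝓔, ⋃ C : Set Θ, ⋃ t : F e C, range (Φ e t), ?_, fun g => ?_⟩
  · exact mk_iUnion_le_of_le h𝓔c hinf fun e => mk_iUnion_le_of_le hsmall hinf fun C =>
      mk_iUnion_le_of_le (hFc e C) hinf fun t => mk_range_le.trans hsmall
  obtain ⟨e, he, heg⟩ := h𝓔 g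
  have hτ : ∀ j, ∃ τ : σ.out → L, Q (e j) → (∀ s, τ s < e j) ∧
      ∀ i, x (g i) j < e j → ∃ s, G (e j) (τ s) i = x (g i) j := by
    intro j
    by_cases hj : Q (e j)
    · obtain ⟨τ, hτ⟩ := hG (e j) hj fun i => x (g i) j
      exact ⟨τ, fun _ => hτ⟩
    · exact ⟨fun _ => a₀, fun h => absurd h hj⟩
  choose τ hτ using hτ
  let C (i : I) : Set Θ := {j | Q (e j) ∧ x (g i) j < e j}
  have hC : ∀ i, ∃ᶠ j in E, j ∈ C i := fun i =>
    ((heg i).and_eventually (h𝓔Q e he)).mono fun _ => And.symm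
  have hp : ∀ i, ∃ p : Θ → σ.out, ∀ j ∈ C i, G (e j) (τ j (p j)) i = x (g i) j := by
    intro i
    have : ∀ j, ∃ s : σ.out, j ∈ C i → G (e j) (τ j s) i = x (g i) j := by
      intro j
      by_cases hj : j ∈ C i
      · obtain ⟨s, hs⟩ := (hτ j hj.1).2 i hj.2
        exact ⟨s, fun _ => hs⟩
      · obtain ⟨j', hj'⟩ := (hC i).exists
        obtain ⟨s, -⟩ := (hτ j' hj'.1).2 i hj'.2
        exact ⟨s, fun h => absurd h hj⟩
    choose p hp using this
    exact ⟨p, hp⟩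
  choose p hp using hp
  have ht : ∀ q : (Θ → σ.out) × Set Θ, ∃ t : Θ → L, (∃ i, (p i, C i) = q) →
      t ∈ F ⟨e, he⟩ q.2 ∧ ∃ᶠ j in D ⊓ 𝓟 q.2, τ j (q.1 j) = t j := by
    intro q
    by_cases hq : ∃ i, (p i, C i) = q
    · obtain ⟨i, rfl⟩ := hq
      obtain ⟨t, ht⟩ := hF ⟨e, he⟩ (C i) (hC i) (fun j => τ j (p i j)) <| by
        rw [eventually_inf_principal]
        exact Eventually.of_forall fun j hj => (hτ j hj.1).1 _
      exact ⟨t, fun _ => ht⟩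
    · exact ⟨fun _ => a₀, fun h => absurd h hq⟩
  choose t ht using ht
  let ψ (q : (Θ → σ.out) × Set Θ) : I → L := Φ e (t q) {j | j ∈ q.2 ∧ τ j (q.1 j) = t q j}
  refine ⟨ψ '' range fun i => (p i, C i), ?_, mk_image_le.trans (mk_set_le _), fun i =>
    ⟨_, mem_image_of_mem _ ⟨i, rfl⟩, ?_⟩⟩
  · rintro _ ⟨q, hq, rfl⟩
    simp only [mem_iUnion]
    exact ⟨⟨e, he⟩, q.2, ⟨t q, (ht q hq).1⟩, _, rfl⟩
  obtain ⟨-, hfr⟩ := ht (p i, C i) ⟨i, rfl⟩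
  rw [frequently_inf_principal] at hfr
  have hex : ∃ a, ∀ j ∈ {j | j ∈ C i ∧ τ j (p i j) = t (p i, C i) j},
      G (e j) (t (p i, C i) j) i = x a j := by
    refine ⟨g i, ?_⟩
    rintro j ⟨hjC, hj⟩
    rw [← hj, hp i j hjC]
  change dite _ _ _ = _
  rw [dif_pos hex]
  by_contra hne
  obtain ⟨j, ⟨hjC, hj⟩, hj'⟩ := (hfr.and_eventually (hxne _ _ hne)).exists
  refine hj' ?_
  rw [← hex.choose_spec j ⟨hjC, hj⟩, ← hj, hp i j hjC]

end Cover

/-- A form of Shelah's revised GCH: above `ℶ_ω`, fewer than `ℶ_ω` many functions from a family of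
size `#L` suffice to cover any given function from a set of size `< ℶ_ω` to `L`. -/
theorem exists_hasCover (L : Type u) (hL : bethOmega ≤ #L) :
    ∃ σ < bethOmega.{u}, ∀ I : Type u, #I < bethOmega.{u} → HasCover #L σ I L := by
  induction hc : #L using WellFoundedLT.induction generalizing L with | _ c ih
  subst hc
  wlog hw : ∃ (_ : LinearOrder L) (_ : WellFoundedLT L), ∀ a : L, #(Iio a) < #L generalizing L
  · obtain ⟨e⟩ : Nonempty ((#L).ord.ToType ≃ L) := Cardinal.eq.1 (mk_ord_toType _)
    obtain ⟨σ, hσ, h⟩ := this (#L).ord.ToType (by rwa [mk_ord_toType])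
      (by rwa [mk_ord_toType]) ⟨inferInstance, inferInstance, fun a => by
        rw [mk_ord_toType]; exact (mk_Iio_lt a (by simp)).trans_eq (mk_ord_toType _)⟩
    refine ⟨σ, hσ, fun I hI => ?_⟩
    have := (h I hI).congr e
    rwa [mk_ord_toType] at this
  obtain ⟨_, _, hIio⟩ := hw
  by_cases hcov : ∀ Θ : Type u, #Θ < bethOmega.{u} → HasCover #L ℵ₀ Θ L
  · exact ⟨ℵ₀, aleph0_lt_bethOmega, hcov⟩
  push Not at hcov
  obtain ⟨Θ, hΘ, hcov⟩ := hcov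
  obtain ⟨D, _, _, hbad⟩ := exists_bad_top hL hΘ hcov
  obtain ⟨f, E, _, _, hcrit⟩ := hbad.exists_isCritical
  let Q (n : ℕ) (b : L) : Prop := ∀ I : Type u, #I < bethOmega.{u} →
    IsCoded (Cardinal.beth (n : Ordinal.{u})) I b
  have hQ : ∀ a : L, bethOmega ≤ #(Iio a) → ∃ n, Q n a := by
    intro a ha
    obtain ⟨σ, hσ, h⟩ := ih _ (hIio a) _ ha rfl
    obtain ⟨n, hn⟩ := exists_le_beth_of_lt_bethOmega hσ
    refine ⟨n, fun I hI => ((h I hI).mono hn).isCoded ?_⟩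
    exact nonempty_coe_sort.1 (mk_ne_zero_iff.1
      ((aleph0_pos.trans_le aleph0_le_bethOmega).trans_le ha).ne')
  have hrich : ∀ᶠ j in E, ∃ n, RichBelow (Q n) (f j) := by
    filter_upwards [hcrit.eventually_not_smallCof hL hΘ] with j hj
    obtain ⟨m, hm, hmu⟩ : ∃ m : L, ↑m < f j ∧ bethOmega ≤ #(Iio m) := by
      by_contra! h
      exact hj (smallCof_of_mk_Iio_lt h)
    exact exists_richBelow hj hm fun a ha => hQ a
      (hmu.trans (mk_le_mk_of_subset (Iio_subset_Iio ha)))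
  obtain ⟨n, hn⟩ : ∃ n, ∃ᶠ j in E, RichBelow (Q n) (f j) := by
    by_contra! h
    obtain ⟨j, ⟨n, hj⟩, hj'⟩ := (hrich.and (eventually_countable_forall.2 h)).exists
    exact hj' n hj
  let E' := E ⊓ 𝓟 {j | RichBelow (Q n) (f j)}
  have : E'.NeBot := frequently_mem_iff_neBot.1 hn
  have hR : ∀ᶠ j in E', RichBelow (Q n) (f j) := mem_inf_of_right (mem_principal_self _)
  obtain ⟨x, hxlt, hxne⟩ := hcrit.bad.exists_family hIio
  refine ⟨_, ?_, fun I hI => (hcrit.mono inf_le_left).hasCover hL hΘ hxlt hxne hI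
    (fun b hb => hb I hI) hR⟩
  rw [mk_prod, lift_id, lift_id, mk_set, ← power_def, mk_out]
  exact mul_lt_of_lt aleph0_le_bethOmega (power_lt_bethOmega (beth_natCast_lt_bethOmega n) hΘ)
    (isStrongLimit_bethOmega.isStrongPrelimit hΘ)

/-- A family of functions dominating modulo the non-stationary ideal. -/
def ClubDominating {α : Type u} [LinearOrder α] (D : Set (α → α)) : Prop :=
  ∀ f : α → α, ∃ g ∈ D, ¬ IsStatIn {a : α | g a < f a}

theorem ClubDominating.exists_club {α : Type u} [LinearOrder α] {D : Set (α → α)}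
    (hD : ClubDominating D) (f : α → α) : ∃ g ∈ D, ∃ C, IsClubIn C ∧ ∀ a ∈ C, f a ≤ g a := by
  obtain ⟨g, hg, h⟩ := hD f
  simp only [IsStatIn, not_forall] at h
  obtain ⟨C, hC, h⟩ := h
  exact ⟨g, hg, C, hC, fun a ha => not_lt.1 fun hlt => h ⟨a, hlt, ha⟩⟩

section Club

variable {α : Type u} [LinearOrder α]

theorem exists_forall_lt (hreg : (#α).IsRegular) (hinit : ∀ a : α, #(Iio a) < #α)
    {ι : Type u} (hι : #ι < #α) (f : ι → α) : ∃ b, ∀ i, f i < b := by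
  by_contra! h
  have hcard : #(⋃ i, Iic (f i)) < #α := by
    refine mk_iUnion_le_sum_mk.trans_lt (sum_lt_of_isRegular hreg hι fun i => ?_)
    rw [← Iio_insert]
    exact mk_insert_le.trans_lt (add_lt_of_lt hreg.aleph0_le (hinit _)
      (one_lt_aleph0.trans_le hreg.aleph0_le))
  have huniv : ⋃ i, Iic (f i) = Set.univ := iUnion_eq_univ_iff.2 h
  rw [huniv, mk_univ] at hcard
  exact hcard.false

theorem exists_forall_le_lt (hreg : (#α).IsRegular) (hinit : ∀ a : α, #(Iio a) < #α)
    {ι : Type u} (hι : #ι < #α) (f : ι → α → α) (β : α) : ∃ b, ∀ i, ∀ γ ≤ β, f i γ < b := by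
  have : #(ι × Iic β) < #α := by
    rw [mk_prod, lift_id, lift_id]
    refine mul_lt_of_lt hreg.aleph0_le hι ?_
    rw [← Iio_insert]
    exact mk_insert_le.trans_lt (add_lt_of_lt hreg.aleph0_le (hinit _)
      (one_lt_aleph0.trans_le hreg.aleph0_le))
  obtain ⟨b, hb⟩ := exists_forall_lt hreg hinit this fun p => f p.1 p.2
  exact ⟨b, fun i γ hγ => hb (i, ⟨γ, hγ⟩)⟩

theorem isClubIn_univ (hreg : (#α).IsRegular) (hinit : ∀ a : α, #(Iio a) < #α) :
    IsClubIn (Set.univ : Set α) := by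
  refine ⟨fun _ _ _ _ _ => trivial, fun a => ?_⟩
  obtain ⟨b, hb⟩ := exists_forall_lt hreg hinit (ι := PUnit.{u + 1})
    (by simpa using one_lt_aleph0.trans_le hreg.aleph0_le) fun _ => a
  exact ⟨b, trivial, hb ⟨⟩⟩

theorem not_isStatIn_of_bddAbove (hreg : (#α).IsRegular) (hinit : ∀ a : α, #(Iio a) < #α)
    {x : Set α} (hx : BddAbove x) : ¬ IsStatIn x := by
  obtain ⟨b, hb⟩ := hx
  intro h
  obtain ⟨a, hax, hab⟩ := h (Ioi b) <| by
    refine ⟨fun s hs ⟨z, hz⟩ a ha => (hs hz).trans_le (ha.1 hz), fun a => ?_⟩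
    obtain ⟨c, -, hc⟩ := (isClubIn_univ hreg hinit).2 (max a b)
    exact ⟨c, (le_max_right a b).trans_lt hc, (le_max_left a b).trans_lt hc⟩
  exact (hb hax).not_gt hab

theorem ClubDominating.mk_le (hreg : (#α).IsRegular) (hinit : ∀ a : α, #(Iio a) < #α)
    {D : Set (α → α)} (hD : ClubDominating D) : #α ≤ #D := by
  by_contra! h
  choose f hf using fun a => exists_forall_lt hreg hinit h fun g : D => g.1 a
  obtain ⟨g, hg, C, hC, hle⟩ := hD.exists_club f
  obtain ⟨a₀⟩ : Nonempty α := mk_ne_zero_iff.1 (aleph0_pos.trans_le hreg.aleph0_le).ne'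
  obtain ⟨a, ha, -⟩ := hC.2 a₀
  exact (hle a ha).not_gt (hf a ⟨g, hg⟩)

/-- For any few clubs, a single `g ∈ D` bounds, on some club, `f` and the successor functions of
all the given clubs. -/
theorem ClubDominating.exists_club_next (hreg : (#α).IsRegular) (hunc : ℵ₀ < #α)
    (hinit : ∀ a : α, #(Iio a) < #α) {D : Set (α → α)} (hD : ClubDominating D) (f : α → α)
    {ι : Type u} (hι : #ι < #α) {C : ι → Set α} (hC : ∀ i, IsClubIn (C i)) :
    ∃ p : D × Set α, IsClubIn p.2 ∧ ∀ γ ∈ p.2,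
      (∀ β ≤ γ, f β ≤ p.1.1 γ) ∧ ∀ i, ∃ δ ∈ C i, γ < δ ∧ δ ≤ p.1.1 γ := by
  choose next hmem hlt using fun i => (hC i).2
  have hι' : #(Option ι) < #α := by
    rw [mk_option]
    exact add_lt_of_lt hreg.aleph0_le hι (one_lt_aleph0.trans hunc)
  choose h hh using exists_forall_le_lt hreg hinit hι' fun o => o.elim f next
  obtain ⟨g, hg, e, he, hle⟩ := hD.exists_club h
  refine ⟨(⟨g, hg⟩, e), he, fun γ hγ => ?_⟩
  have hγe := hle γ hγ
  exact ⟨fun β hβ => (hh γ none β hβ).le.trans hγe, fun i => ⟨next i γ, hmem i γ, hlt i γ,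
    (hh γ (some i) γ le_rfl).le.trans hγe⟩⟩

theorem ClubDominating.exists_sequence (hreg : (#α).IsRegular) (hunc : ℵ₀ < #α)
    (hinit : ∀ a : α, #(Iio a) < #α) {D : Set (α → α)} (hD : ClubDominating D) (f : α → α)
    {Θ : Type u} [LinearOrder Θ] [WellFoundedLT Θ] (hΘ : #Θ < #α) :
    ∃ (g : Θ → D) (C : Θ → Set α), (∀ i, IsClubIn (C i)) ∧
      (∀ i, ∀ γ ∈ C i, ∀ β ≤ γ, f β ≤ (g i).1 γ) ∧
      ∀ i j, i < j → ∀ γ ∈ C j, ∃ δ ∈ C i, γ < δ ∧ δ ≤ (g j).1 γ := by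
  have hstep : ∀ (i : Θ) (C : Iio i → Set α), ∃ p : D × Set α, (∀ i, IsClubIn (C i)) →
      IsClubIn p.2 ∧ ∀ γ ∈ p.2,
      (∀ β ≤ γ, f β ≤ p.1.1 γ) ∧ ∀ i, ∃ δ ∈ C i, γ < δ ∧ δ ≤ p.1.1 γ := by
    intro i C
    by_cases hC : ∀ i, IsClubIn (C i)
    · obtain ⟨p, hp⟩ := hD.exists_club_next hreg hunc hinit f
        ((mk_set_le (Iio i)).trans_lt hΘ) hC
      exact ⟨p, fun _ => hp⟩
    · obtain ⟨g, hg, -⟩ := hD f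
      exact ⟨(⟨g, hg⟩, ∅), fun h => absurd h hC⟩
  choose pick hpick using hstep
  let p : Θ → D × Set α := (wellFounded_lt (α := Θ)).fix
    fun i ih => pick i fun j => (ih j j.2).2
  have hp : ∀ i, p i = pick i fun j => (p j).2 := fun i => (wellFounded_lt (α := Θ)).fix_eq _ i
  have hclub : ∀ i, IsClubIn (p i).2 := by
    intro i
    induction i using WellFoundedLT.induction with | _ i ih
    rw [hp]
    exact (hpick i _ fun j => ih j j.2).1
  have key := fun i => hpick i (fun j => (p j).2) fun j => hclub j
  simp only [← hp] at key
  exact ⟨fun i => (p i).1, fun i => (p i).2, hclub,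
    fun i γ hγ => ((key i).2 γ hγ).1, fun i j hij γ hγ => ((key j).2 γ hγ).2 ⟨i, hij⟩⟩

variable [WellFoundedLT α]

theorem exists_isLUB {s : Set α} (hs : BddAbove s) : ∃ a, IsLUB s a := by
  obtain ⟨a, ha, hmin⟩ := (wellFounded_lt (α := α)).has_min (upperBounds s) hs
  exact ⟨a, ha, fun b hb => not_lt.1 (hmin b hb)⟩

theorem IsClubIn.exists_isGreatest {C : Set α} (hC : IsClubIn C) {c β : α} (hc : c ∈ C)
    (hcβ : c ≤ β) : ∃ γ, IsGreatest {a ∈ C | a ≤ β} γ := by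
  have hub : β ∈ upperBounds {a ∈ C | a ≤ β} := fun a ha => ha.2
  obtain ⟨γ, hγ⟩ := exists_isLUB (s := {a ∈ C | a ≤ β}) ⟨β, hub⟩
  exact ⟨γ, ⟨hC.1 {a ∈ C | a ≤ β} (fun a ha => ha.1) ⟨c, hc, hcβ⟩ γ hγ, hγ.2 hub⟩, hγ.1⟩

theorem ClubDominating.exists_bddDominating (hreg : (#α).IsRegular) (hunc : ℵ₀ < #α)
    (hinit : ∀ a : α, #(Iio a) < #α) (hbeth : bethOmega ≤ #α) {D : Set (α → α)}
    (hD : ClubDominating D) : ∃ D' : Set (α → α), #D' ≤ #D ∧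
      ∀ f : α → α, ∃ g ∈ D', BddAbove {a : α | g a < f a} := by
  obtain ⟨σ, hσ, hcov⟩ := exists_hasCover D (hbeth.trans (hD.mk_le hreg hinit))
  let c := Order.succ (max σ ℵ₀)
  let Θ := c.ord.ToType
  have hc : #Θ = c := mk_ord_toType c
  have hΘreg : (#Θ).IsRegular := hc ▸ isRegular_succ (le_max_right _ _)
  have hΘinit : ∀ i : Θ, #(Iio i) < #Θ := fun i => mk_Iio_lt i (by simp [Θ])
  have hσΘ : σ < #Θ := hc ▸ (le_max_left _ _).trans_lt (Order.lt_succ _)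
  have hΘ : #Θ < bethOmega := by
    rw [hc]
    exact (Order.succ_le_of_lt (cantor _)).trans_lt
      (isStrongLimit_bethOmega.isStrongPrelimit (max_lt hσ aleph0_lt_bethOmega))
  have hΘα : #Θ < #α := hΘ.trans_le hbeth
  obtain ⟨F, hFc, hF⟩ := hcov Θ hΘ
  choose G hG using fun t : Θ → D =>
    exists_forall_le_lt hreg hinit hΘα fun i => (t i).1
  refine ⟨(fun t => G t ∘ G t) '' F, mk_image_le.trans hFc, fun f => ?_⟩
  obtain ⟨g, C, hC, hf, hnext⟩ := hD.exists_sequence hreg hunc hinit f hΘα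
  obtain ⟨T, hT, hTc, hTg⟩ := hF g
  have hΘne : Nonempty Θ := mk_ne_zero_iff.1 (aleph0_pos.trans_le hΘreg.aleph0_le).ne'
  obtain ⟨t, htT, ht⟩ : ∃ t ∈ T, ∀ i, ∃ j, i < j ∧ t j = g j := by
    by_contra! h
    choose! k hk using h
    obtain ⟨j, hj⟩ := exists_forall_lt hΘreg hΘinit (hTc.trans_lt hσΘ) fun t : T => k t
    obtain ⟨t, htT, htj⟩ := hTg j
    exact hk t htT j (hj ⟨t, htT⟩) htj
  refine ⟨_, mem_image_of_mem _ (hT htT), ?_⟩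
  obtain ⟨a₀⟩ : Nonempty α := mk_ne_zero_iff.1 (aleph0_pos.trans_le hreg.aleph0_le).ne'
  choose a ha _ using fun i => (hC i).2 a₀
  obtain ⟨b, hb⟩ := exists_forall_lt hreg hinit hΘα a
  refine ⟨b, fun β hβ => not_lt.1 fun hbβ => (?_ : f β ≤ G t (G t β)).not_gt hβ⟩
  choose γ hγ using fun i => (hC i).exists_isGreatest (ha i) ((hb i).trans hbβ).le
  obtain ⟨i, hi, hmin⟩ : ∃ i, t i = g i ∧ ∀ j, t j = g j → γ i ≤ γ j := by
    obtain ⟨j, -, hj⟩ := ht hΘne.some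
    obtain ⟨i, hi, hmin⟩ := (InvImage.wf γ wellFounded_lt).has_min {i | t i = g i} ⟨j, hj⟩
    exact ⟨i, hi, fun j hj => not_lt.1 (hmin j hj)⟩
  obtain ⟨j, hij, hj⟩ := ht i
  obtain ⟨δ, hδC, hδ, hδg⟩ := hnext i j hij (γ j) (hγ j).1.1
  have hβδ : β < δ := by
    by_contra! h
    exact (hδ.trans_le ((hγ i).2 ⟨hδC, h⟩)).not_ge (hmin j hj)
  calc f β ≤ (g i).1 δ := hf i δ hδC β hβδ.le
    _ = (t i).1 δ := by rw [hi]
    _ ≤ G t (G t β) := (hG t _ i δ ?_).le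
  refine hδg.trans ?_
  rw [← hj]
  exact (hG t β j _ (hγ j).1.2).le

end Club

/-- For every regular uncountable cardinal `κ ≥ ℶ_ω` we have `d_κ = d^cl_κ`.
Here `κ` is represented as a well-ordered type `α` of regular uncountable cardinality
all of whose proper initial segments are of size `< #α`. -/
theorem bddDominating_eq_clubDominating {α : Type*} [LinearOrder α] [WellFoundedLT α]
    (hreg : (#α).IsRegular) (hunc : ℵ₀ < #α)
    (hinit : ∀ a : α, #(Set.Iio a) < #α)
    (hbeth : Cardinal.beth Ordinal.omega0 ≤ #α) :
    bddDominatingNumber α = clubDominatingNumber α := by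
  have hclub : ∀ D : Set (α → α), (∀ f : α → α, ∃ g ∈ D, BddAbove {a : α | g a < f a}) →
      ClubDominating D := fun D hD f => by
    obtain ⟨g, hg, h⟩ := hD f
    exact ⟨g, hg, not_isStatIn_of_bddAbove hreg hinit h⟩
  have : Nonempty α := mk_ne_zero_iff.1 (aleph0_pos.trans_le hreg.aleph0_le).ne'
  have huniv : ∀ f : α → α, ∃ g ∈ (Set.univ : Set (α → α)), BddAbove {a : α | g a < f a} :=
    fun f => ⟨f, trivial, by simp⟩
  apply le_antisymm
  · refine le_csInf ⟨#(Set.univ : Set (α → α)), Set.univ, hclub _ huniv, rfl⟩ ?_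
    rintro _ ⟨D, hD, rfl⟩
    obtain ⟨D', hD'c, hD'⟩ := ClubDominating.exists_bddDominating hreg hunc hinit hbeth hD
    have hle : bddDominatingNumber α ≤ #D' := csInf_le' ⟨D', hD', rfl⟩
    exact hle.trans hD'c
  · refine le_csInf ⟨#(Set.univ : Set (α → α)), Set.univ, huniv, rfl⟩ ?_
    rintro _ ⟨D, hD, rfl⟩
    exact csInf_le' ⟨D, hclub D hD, rfl⟩
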